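/- Let f : G → H be a surjective homomorphism of finitely generated groups with finitely generated kernel K = ker f, and suppose asdim H ≤ n and asdim K ≤ k. Suppose the Gromov functions γ_H (for the inequality asdim H ≤ n) and γ_K (for the inequality asdim K ≤ k), taken with respect to word metrics on H and K, are bounded above by polynomials, and that K has polynomial distortion in G. Then asdim G ≤ (k+1)(n+1) and Gromov's function γ_G taken for the inequality asdim G ≤ (k+1)(n+1) (with respect to a word metric on G) is bounded above by a polynomial. -/

import Mathlib

/-- `𝒰` is a cover of `X`. -/
def IsCover {X : Type*} (𝒰 : Set (Set X)) : Prop := ∀ x : X, ∃ U ∈ 𝒰, x ∈ U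

/-- `lam` is a Lebesgue number for the cover `𝒰` with respect to the distance
function `d`: every set of diameter at most `lam` is contained in a member of `𝒰`.
The condition `L(𝒰) ≥ lam` is formalized as this predicate. -/
def IsLebesgueNumber {X : Type*} (d : X → X → ℝ) (𝒰 : Set (Set X)) (lam : ℝ) : Prop :=
  ∀ A : Set X, (∀ x ∈ A, ∀ y ∈ A, d x y ≤ lam) → ∃ U ∈ 𝒰, A ⊆ U

/-- The multiplicity of the family `𝒰` is at most `n`: any finitely many distinct
members of `𝒰` with a common point number at most `n`. -/
def MultiplicityLE {X : Type*} (𝒰 : Set (Set X)) (n : ℕ) : Prop :=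
  ∀ F : Finset (Set X), ↑F ⊆ 𝒰 → (⋂₀ (F : Set (Set X))).Nonempty → F.card ≤ n

/-- All members of the family `𝒰` have diameter at most `D` w.r.t. `d`. -/
def FamilyDiamLE {X : Type*} (d : X → X → ℝ) (𝒰 : Set (Set X)) (D : ℝ) : Prop :=
  ∀ U ∈ 𝒰, ∀ x ∈ U, ∀ y ∈ U, d x y ≤ D

/-- The family `𝒰` is uniformly bounded w.r.t. `d`. -/
def UniformlyBounded {X : Type*} (d : X → X → ℝ) (𝒰 : Set (Set X)) : Prop :=
  ∃ D : ℝ, FamilyDiamLE d 𝒰 D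

/-- `ad_X(lam) ≤ c` (for a real bound `c`): there is a uniformly bounded cover `𝒰`
with Lebesgue number at least `lam` whose multiplicity, minus one, is at most `c`. -/
def adLE {X : Type*} (d : X → X → ℝ) (lam : ℝ) (c : ℝ) : Prop :=
  ∃ 𝒰 : Set (Set X), IsCover 𝒰 ∧ UniformlyBounded d 𝒰 ∧ IsLebesgueNumber d 𝒰 lam ∧
    ∀ F : Finset (Set X), ↑F ⊆ 𝒰 → (⋂₀ (F : Set (Set X))).Nonempty → (F.card : ℝ) ≤ c + 1

/-- `asdim (X,d) ≤ n`: for every `r` there are `n+1` uniformly bounded, `r`-disjoint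
families of subsets of `X` whose union covers `X`. -/
def AsdimLE {X : Type*} (d : X → X → ℝ) (n : ℕ) : Prop :=
  ∀ r : ℝ, ∃ 𝒰 : Fin (n + 1) → Set (Set X),
    (∀ i, UniformlyBounded d (𝒰 i)) ∧
    (∀ i, ∀ U ∈ 𝒰 i, ∀ V ∈ 𝒰 i, U ≠ V → ∀ x ∈ U, ∀ y ∈ V, r ≤ d x y) ∧
    IsCover (⋃ i, 𝒰 i)

/-- The word norm of `g` with respect to the generating set `S`. -/
noncomputable def wordNorm {G : Type*} [Group G] (S : Set G) (g : G) : ℕ :=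
  sInf {n : ℕ | ∃ l : List G, (∀ s ∈ l, s ∈ S) ∧ l.prod = g ∧ l.length = n}

/-- The (left-invariant) word metric on `G` determined by the generating set `S`. -/
noncomputable def wordDist {G : Type*} [Group G] (S : Set G) (g h : G) : ℝ :=
  (wordNorm S (g⁻¹ * h) : ℝ)

/-- Gromov's function `γ_X` for the inequality `asdim X ≤ m` is bounded by `p`:
for every `λ > 0` there is a cover `𝒰` of `X` with Lebesgue number at least `λ`,
multiplicity at most `m + 1`, and diameter at most `p(λ)`. -/
def GromovLE {X : Type*} (d : X → X → ℝ) (m : ℕ) (p : ℝ → ℝ) : Prop :=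
  ∀ lam : ℝ, 0 < lam → ∃ 𝒰 : Set (Set X), IsCover 𝒰 ∧ IsLebesgueNumber d 𝒰 lam ∧
    MultiplicityLE 𝒰 (m + 1) ∧ FamilyDiamLE d 𝒰 (p lam)

section WordNorm

variable {G : Type*} [Group G] {S : Set G}

/-- A symmetric generating set represents every element by a word of length `wordNorm S g`. -/
theorem exists_list_of_wordNorm (hsymm : ∀ s ∈ S, s⁻¹ ∈ S) (hgen : Subgroup.closure S = ⊤)
    (g : G) : ∃ l : List G, (∀ s ∈ l, s ∈ S) ∧ l.prod = g ∧ l.length = wordNorm S g := by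
  apply Nat.sInf_mem (s := {n : ℕ | ∃ l : List G, (∀ s ∈ l, s ∈ S) ∧ l.prod = g ∧ l.length = n})
  have hg : g ∈ (Subgroup.closure S).toSubmonoid := hgen ▸ Subgroup.mem_top g
  rw [Subgroup.closure_toSubmonoid] at hg
  obtain ⟨l, hl, hprod⟩ := Submonoid.exists_list_of_mem_closure hg
  refine ⟨l.length, l, fun s hs => ?_, hprod, rfl⟩
  rcases hl s hs with h | h
  · exact h
  · simpa using hsymm _ h

theorem wordNorm_prod_le (l : List G) (hl : ∀ s ∈ l, s ∈ S) : wordNorm S l.prod ≤ l.length :=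
  Nat.sInf_le ⟨l, hl, rfl, rfl⟩

theorem wordNorm_mul_le (hsymm : ∀ s ∈ S, s⁻¹ ∈ S) (hgen : Subgroup.closure S = ⊤) (g h : G) :
    wordNorm S (g * h) ≤ wordNorm S g + wordNorm S h := by
  obtain ⟨l, hl, hlg, hln⟩ := exists_list_of_wordNorm hsymm hgen g
  obtain ⟨m, hm, hmh, hmn⟩ := exists_list_of_wordNorm hsymm hgen h
  rw [← hln, ← hmn, ← List.length_append, ← hlg, ← hmh, ← List.prod_append]
  refine wordNorm_prod_le _ fun s hs => ?_
  rcases List.mem_append.1 hs with h | h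
  exacts [hl s h, hm s h]

theorem wordNorm_inv_le (hsymm : ∀ s ∈ S, s⁻¹ ∈ S) (hgen : Subgroup.closure S = ⊤) (g : G) :
    wordNorm S g⁻¹ ≤ wordNorm S g := by
  obtain ⟨l, hl, hlg, hln⟩ := exists_list_of_wordNorm hsymm hgen g
  have h := wordNorm_prod_le (S := S) (l.map (·⁻¹)).reverse (by
    intro s hs
    simp only [List.mem_reverse, List.mem_map] at hs
    obtain ⟨t, ht, rfl⟩ := hs
    exact hsymm t (hl t ht))
  rw [← List.prod_inv_reverse, hlg] at h
  simpa [hln] using h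

theorem wordNorm_map_le {H : Type*} [Group H] (f : G →* H) (hsymm : ∀ s ∈ S, s⁻¹ ∈ S)
    (hgen : Subgroup.closure S = ⊤) (g : G) : wordNorm (f '' S) (f g) ≤ wordNorm S g := by
  obtain ⟨l, hl, hlg, hln⟩ := exists_list_of_wordNorm hsymm hgen g
  have h := wordNorm_prod_le (S := f '' S) (l.map f) (by
    intro s hs
    obtain ⟨t, ht, rfl⟩ := List.mem_map.1 hs
    exact ⟨t, hl t ht, rfl⟩)
  rwa [← map_list_prod, hlg, List.length_map, hln] at h

theorem exists_lift_wordNorm_le {H : Type*} [Group H] {f : G →* H}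
    (hsurj : Function.Surjective f) (hsymm : ∀ s ∈ S, s⁻¹ ∈ S)
    (hgen : Subgroup.closure S = ⊤) (h : H) :
    ∃ g : G, f g = h ∧ wordNorm S g ≤ wordNorm (f '' S) h := by
  obtain ⟨l, hl, hlh, hln⟩ := exists_list_of_wordNorm (S := f '' S)
    (by rintro _ ⟨s, hs, rfl⟩; exact ⟨s⁻¹, hsymm s hs, map_inv f s⟩)
    (by rw [← MonoidHom.map_closure, hgen, ← MonoidHom.range_eq_map,
      MonoidHom.range_eq_top.2 hsurj]) h
  obtain ⟨m, hm, rfl⟩ : ∃ m : List G, (∀ s ∈ m, s ∈ S) ∧ m.map f = l := by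
    clear hlh hln
    induction l with
    | nil => exact ⟨[], by simp, rfl⟩
    | cons a l ih =>
      obtain ⟨m, hm, hml⟩ := ih fun s hs => hl s (List.mem_cons_of_mem _ hs)
      obtain ⟨b, hb, hba⟩ := hl a List.mem_cons_self
      refine ⟨b :: m, ?_, by simp [hba, hml]⟩
      intro s hs
      rcases List.mem_cons.1 hs with rfl | hs
      exacts [hb, hm s hs]
  refine ⟨m.prod, by rw [map_list_prod, hlh], ?_⟩
  rw [← hln, List.length_map]
  exact wordNorm_prod_le m hm

/-- A homomorphism is Lipschitz for the word norms if the source generating set is finite. -/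
theorem exists_wordNorm_map_le_mul {K : Type*} [Group K] {T : Set K} (hTfin : T.Finite)
    (hTsymm : ∀ t ∈ T, t⁻¹ ∈ T) (hTgen : Subgroup.closure T = ⊤) (φ : K →* G)
    (hsymm : ∀ s ∈ S, s⁻¹ ∈ S) (hgen : Subgroup.closure S = ⊤) :
    ∃ C : ℕ, ∀ a : K, wordNorm S (φ a) ≤ C * wordNorm T a := by
  obtain ⟨C, hC⟩ := (hTfin.image fun t => wordNorm S (φ t)).bddAbove
  refine ⟨C, fun a => ?_⟩
  obtain ⟨l, hl, rfl, hln⟩ := exists_list_of_wordNorm hTsymm hTgen a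
  rw [← hln]
  clear hln
  induction l with
  | nil => simpa using wordNorm_prod_le (S := S) [] (by simp)
  | cons b l ih =>
    have h1 := ih fun s hs => hl s (List.mem_cons_of_mem _ hs)
    have h2 : wordNorm S (φ b) ≤ C := hC ⟨b, hl b List.mem_cons_self, rfl⟩
    have h3 := wordNorm_mul_le hsymm hgen (φ b) (φ l.prod)
    rw [List.prod_cons, map_mul, List.length_cons, mul_add, mul_one]
    omega

theorem wordDist_comm_le (hsymm : ∀ s ∈ S, s⁻¹ ∈ S) (hgen : Subgroup.closure S = ⊤) (x y : G) :
    wordDist S x y ≤ wordDist S y x := by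
  unfold wordDist
  have h := wordNorm_inv_le hsymm hgen (y⁻¹ * x)
  rw [mul_inv_rev, inv_inv] at h
  exact_mod_cast h

theorem wordDist_triangle (hsymm : ∀ s ∈ S, s⁻¹ ∈ S) (hgen : Subgroup.closure S = ⊤)
    (x y z : G) : wordDist S x z ≤ wordDist S x y + wordDist S y z := by
  unfold wordDist
  have h := wordNorm_mul_le hsymm hgen (x⁻¹ * y) (y⁻¹ * z)
  rw [show x⁻¹ * y * (y⁻¹ * z) = x⁻¹ * z by group] at h
  exact_mod_cast h

theorem wordDist_nonneg (x y : G) : 0 ≤ wordDist S x y := Nat.cast_nonneg _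

theorem wordDist_mul_left (g x y : G) : wordDist S (g * x) (g * y) = wordDist S x y := by
  unfold wordDist
  rw [show (g * x)⁻¹ * (g * y) = x⁻¹ * y by group]

theorem wordDist_map_le {H : Type*} [Group H] (f : G →* H) (hsymm : ∀ s ∈ S, s⁻¹ ∈ S)
    (hgen : Subgroup.closure S = ⊤) (x y : G) :
    wordDist (f '' S) (f x) (f y) ≤ wordDist S x y := by
  unfold wordDist
  have h := wordNorm_map_le f hsymm hgen (x⁻¹ * y)
  rw [map_mul, map_inv] at h
  exact_mod_cast h

/-- The preimage of a set of diameter at most `D` retracts onto a translate of the kernel,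
moving points by at most `D`. -/
theorem exists_projection_to_ker {H : Type*} [Group H] {f : G →* H}
    (hsurj : Function.Surjective f) (hsymm : ∀ s ∈ S, s⁻¹ ∈ S)
    (hgen : Subgroup.closure S = ⊤) {U : Set H} {D : ℝ}
    (hU : ∀ x ∈ U, ∀ y ∈ U, wordDist (f '' S) x y ≤ D) :
    ∃ p : G → f.ker, ∀ x y, f x ∈ U → f y ∈ U →
      wordDist S (p x : G) (p y) ≤ wordDist S x y + 2 * D ∧
      wordDist S x y ≤ wordDist S (p x : G) (p y) + 2 * D := by
  rcases U.eq_empty_or_nonempty with rfl | ⟨u, hu⟩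
  · exact ⟨fun _ => 1, by simp⟩
  obtain ⟨g, rfl⟩ := hsurj u
  choose w hw hwn using fun x => exists_lift_wordNorm_le hsurj hsymm hgen ((f g)⁻¹ * f x)
  let p : G → f.ker := fun x => ⟨g⁻¹ * x * (w x)⁻¹, by
    rw [MonoidHom.mem_ker, map_mul, map_mul, map_inv, map_inv, hw]; group⟩
  have hp : ∀ x, f x ∈ U → wordDist S (g * p x) x ≤ D := by
    intro x hx
    refine le_trans ?_ (hU _ hu _ hx)
    unfold wordDist
    rw [show (g * (p x : G))⁻¹ * x = w x by simp only [p]; group]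
    exact_mod_cast hwn x
  refine ⟨p, fun x y hx hy => ?_⟩
  rw [← wordDist_mul_left g]
  have hx1 := hp x hx
  have hy1 := hp y hy
  have hx2 := (wordDist_comm_le hsymm hgen x (g * p x)).trans hx1
  have hy2 := (wordDist_comm_le hsymm hgen y (g * p y)).trans hy1
  have t := wordDist_triangle hsymm hgen
  constructor
  · linarith [t (g * p x) x (g * p y), t x y (g * p y)]
  · linarith [t x (g * p x) y, t (g * p x) (g * p y) y]

end WordNorm

/-- On `[0, ∞)` every real polynomial is dominated by a nonnegative monotone one. -/
theorem Polynomial.exists_monotoneOn_nonneg_ge (P : Polynomial ℝ) :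
    ∃ Q : Polynomial ℝ, (∀ x, 0 ≤ x → P.eval x ≤ Q.eval x) ∧ (∀ x, 0 ≤ x → 0 ≤ Q.eval x) ∧
      ∀ x y, 0 ≤ x → x ≤ y → Q.eval x ≤ Q.eval y := by
  induction P using Polynomial.induction_on' with
  | add p q hp hq =>
    obtain ⟨p', h1, h2, h3⟩ := hp
    obtain ⟨q', h4, h5, h6⟩ := hq
    refine ⟨p' + q', fun x hx => ?_, fun x hx => ?_, fun x y hx hxy => ?_⟩ <;>
      simp only [Polynomial.eval_add]
    · exact add_le_add (h1 x hx) (h4 x hx)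
    · exact add_nonneg (h2 x hx) (h5 x hx)
    · exact add_le_add (h3 x y hx hxy) (h6 x y hx hxy)
  | monomial i a =>
    refine ⟨Polynomial.monomial i |a|, fun x hx => ?_, fun x hx => ?_, fun x y hx hxy => ?_⟩ <;>
      simp only [Polynomial.eval_monomial]
    · gcongr
      exact le_abs_self a
    · positivity
    · gcongr

/-- The family of the sets `f⁻¹(U) ∩ (p U)⁻¹(V)` for `U ∈ 𝒰` and `V ∈ 𝒱`. -/
def fiberedFamily {X Y Z : Type*} (f : X → Y) (p : Set Y → X → Z) (𝒰 : Set (Set Y))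
    (𝒱 : Set (Set Z)) : Set (Set X) :=
  {W | ∃ U ∈ 𝒰, ∃ V ∈ 𝒱, W = {x | f x ∈ U ∧ p U x ∈ V}}

theorem MultiplicityLE.fiberedFamily {X Y Z : Type*} {f : X → Y} {p : Set Y → X → Z}
    {𝒰 : Set (Set Y)} {𝒱 : Set (Set Z)} {a b : ℕ} (h𝒰 : MultiplicityLE 𝒰 a)
    (h𝒱 : MultiplicityLE 𝒱 b) : MultiplicityLE (fiberedFamily f p 𝒰 𝒱) (b * a) := by
  classical
  rintro F hF ⟨x, hx⟩
  replace hF : ∀ W : Set X, W ∈ F → W ∈ _root_.fiberedFamily f p 𝒰 𝒱 := fun W hW => hF hW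
  choose! u hu v hv h using hF
  have hxF : ∀ W ∈ F, f x ∈ u W ∧ p (u W) x ∈ v W := by
    intro W hW
    have hxW : x ∈ W := hx W hW
    rw [h W hW] at hxW
    exact hxW
  have hbase : (F.image u).card ≤ a := by
    apply h𝒰
    · intro U hU
      obtain ⟨W, hW, rfl⟩ := Finset.mem_image.1 (Finset.mem_coe.1 hU)
      exact hu W hW
    · refine ⟨f x, fun U hU => ?_⟩
      obtain ⟨W, hW, rfl⟩ := Finset.mem_image.1 (Finset.mem_coe.1 hU)
      exact (hxF W hW).1
  refine (Finset.card_le_mul_card_image F b fun U _ => ?_).trans (Nat.mul_le_mul_left b hbase)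
  have hinj : Set.InjOn v (F.filter fun W => u W = U : Finset (Set X)) := by
    intro W hW W' hW' hvv
    simp only [Finset.coe_filter, Set.mem_ofPred_eq] at hW hW'
    rw [h W hW.1, h W' hW'.1, hW.2, hW'.2, hvv]
  rw [← Finset.card_image_of_injOn hinj]
  apply h𝒱
  · intro V hV
    obtain ⟨W, hW, rfl⟩ := Finset.mem_image.1 (Finset.mem_coe.1 hV)
    exact hv W (Finset.mem_filter.1 hW).1
  · refine ⟨p U x, fun V hV => ?_⟩
    obtain ⟨W, hW, rfl⟩ := Finset.mem_image.1 (Finset.mem_coe.1 hV)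
    obtain ⟨hWF, rfl⟩ := Finset.mem_filter.1 hW
    exact (hxF W hWF).2

/-- Let `f : G → H` be a surjective homomorphism of finitely generated
groups with finitely generated kernel `K = ker f`, with `asdim H ≤ n`, `asdim K ≤ k`,
whose Gromov functions `γ_H` (for `asdim H ≤ n`) and `γ_K` (for `asdim K ≤ k`) are
bounded by polynomials, and such that `K` has polynomial distortion in `G`. Then
`asdim G ≤ (k+1)(n+1)` and the Gromov function `γ_G` for this inequality is bounded
by a polynomial. -/
theorem statement16 (G H : Type*) [Group G] [Group H] (f : G →* H)
    (hsurj : Function.Surjective f)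
    (S : Set G) (hSfin : S.Finite) (hSsymm : ∀ s ∈ S, s⁻¹ ∈ S)
    (hSgen : Subgroup.closure S = ⊤)
    (SK : Set ↥f.ker) (hKfin : SK.Finite) (hKsymm : ∀ s ∈ SK, s⁻¹ ∈ SK)
    (hKgen : Subgroup.closure SK = ⊤)
    (n k : ℕ)
    (hH : AsdimLE (wordDist (f '' S)) n)
    (hK : AsdimLE (wordDist SK) k)
    (PH : Polynomial ℝ) (hPH : GromovLE (wordDist (f '' S)) n PH.eval)
    (PK : Polynomial ℝ) (hPK : GromovLE (wordDist SK) k PK.eval)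
    (PD : Polynomial ℝ)
    (hdist : ∀ x y : ↥f.ker, wordDist SK x y ≤ PD.eval (wordDist S (x : G) (y : G))) :
    AsdimLE (wordDist S) ((k + 1) * (n + 1)) ∧
    ∃ P : Polynomial ℝ, GromovLE (wordDist S) ((k + 1) * (n + 1)) P.eval := by
  classical
  have hDist : ∃ Q : Polynomial ℝ, ∃ C : ℝ, 0 ≤ C ∧ (∀ x, 0 ≤ x → 0 ≤ Q.eval x) ∧
      (∀ x y, 0 ≤ x → x ≤ y → Q.eval x ≤ Q.eval y) ∧
      ∀ D : ℝ, ∃ p : Set H → G → f.ker,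
        ∀ U : Set H, (∀ x ∈ U, ∀ y ∈ U, wordDist (f '' S) x y ≤ D) → ∀ x y, f x ∈ U → f y ∈ U →
          wordDist SK (p U x) (p U y) ≤ Q.eval (wordDist S x y + 2 * D) ∧
          wordDist S x y ≤ C * wordDist SK (p U x) (p U y) + 2 * D := by
    obtain ⟨Q, hQ1, hQ2, hQ3⟩ := PD.exists_monotoneOn_nonneg_ge
    obtain ⟨C, hC⟩ := exists_wordNorm_map_le_mul hKfin hKsymm hKgen f.ker.subtype hSsymm hSgen
    refine ⟨Q, C, Nat.cast_nonneg C, hQ2, hQ3, fun D => ?_⟩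
    have key : ∀ U : Set H, ∃ p : G → f.ker,
        (∀ x ∈ U, ∀ y ∈ U, wordDist (f '' S) x y ≤ D) → ∀ x y, f x ∈ U → f y ∈ U →
          wordDist SK (p x) (p y) ≤ Q.eval (wordDist S x y + 2 * D) ∧
          wordDist S x y ≤ C * wordDist SK (p x) (p y) + 2 * D := by
      intro U
      by_cases hU : ∀ x ∈ U, ∀ y ∈ U, wordDist (f '' S) x y ≤ D
      · obtain ⟨p, hp⟩ := exists_projection_to_ker hsurj hSsymm hSgen hU
        refine ⟨p, fun _ x y hx hy => ⟨?_, ?_⟩⟩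
        · exact (hdist _ _).trans ((hQ1 _ (wordDist_nonneg _ _)).trans
            (hQ3 _ _ (wordDist_nonneg _ _) (hp x y hx hy).1))
        · refine (hp x y hx hy).2.trans (add_le_add_left ?_ _)
          unfold wordDist
          exact_mod_cast hC ((p x)⁻¹ * p y)
      · exact ⟨fun _ => 1, fun h => absurd h hU⟩
    choose p hp using key
    exact ⟨p, hp⟩
  obtain ⟨Q, C, hC, hQ0, hQmono, hproj⟩ := hDist
  constructor
  · intro r
    obtain ⟨𝒰, h𝒰b, h𝒰d, h𝒰c⟩ := hH r
    choose D hD using h𝒰b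
    obtain ⟨D', hD'⟩ := (Set.finite_range D).bddAbove
    obtain ⟨p, hp⟩ := hproj D'
    have h𝒰D : ∀ i, FamilyDiamLE (wordDist (f '' S)) (𝒰 i) D' := fun i U hU x hx y hy =>
      (hD i U hU x hx y hy).trans (hD' ⟨i, rfl⟩)
    obtain ⟨𝒱, h𝒱b, h𝒱d, h𝒱c⟩ := hK (Q.eval (r + 2 * D') + 1)
    have hcard : Fintype.card (Option (Fin (k + 1) × Fin (n + 1))) = (k + 1) * (n + 1) + 1 := by
      simp
    let e := Fintype.equivFinOfCardEq hcard
    let 𝒲 : Option (Fin (k + 1) × Fin (n + 1)) → Set (Set G) := fun o =>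
      o.elim ∅ fun ji => fiberedFamily f p (𝒰 ji.2) (𝒱 ji.1)
    refine ⟨fun m => 𝒲 (e.symm m), fun m => ?_, fun m => ?_, fun x => ?_⟩
    · beta_reduce
      generalize e.symm m = o
      obtain _ | ⟨j, i⟩ := o
      · exact ⟨0, fun W hW => absurd hW (Set.notMem_empty W)⟩
      obtain ⟨E, hE⟩ := h𝒱b j
      refine ⟨C * E + 2 * D', ?_⟩
      rintro _ ⟨U, hU, V, hV, rfl⟩ x hx y hy
      refine (hp U (h𝒰D i U hU) x y hx.1 hy.1).2.trans ?_
      gcongr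
      exact hE V hV _ hx.2 _ hy.2
    · beta_reduce
      generalize e.symm m = o
      obtain _ | ⟨j, i⟩ := o
      · exact fun W hW => absurd hW (Set.notMem_empty W)
      rintro _ ⟨U, hU, V, hV, rfl⟩ _ ⟨U', hU', V', hV', rfl⟩ hne x hx y hy
      by_cases hUU : U = U'
      · subst hUU
        have hVV : V ≠ V' := by
          rintro rfl
          exact hne rfl
        by_contra! hlt
        have h1 := (hp U (h𝒰D i U hU) x y hx.1 hy.1).1
        have h2 := h𝒱d j V hV V' hV' hVV _ hx.2 _ hy.2
        have hD0 : 0 ≤ D' := (wordDist_nonneg _ _).trans (h𝒰D i U hU _ hx.1 _ hx.1)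
        have h3 := hQmono (wordDist S x y + 2 * D') (r + 2 * D')
          (by linarith [wordDist_nonneg (S := S) x y]) (by linarith)
        linarith
      · exact (h𝒰d i U hU U' hU' hUU _ hx.1 _ hy.1).trans (wordDist_map_le f hSsymm hSgen x y)
    · obtain ⟨U, hU, hxU⟩ := h𝒰c (f x)
      obtain ⟨i, hU⟩ := Set.mem_iUnion.1 hU
      obtain ⟨V, hV, hxV⟩ := h𝒱c (p U x)
      obtain ⟨j, hV⟩ := Set.mem_iUnion.1 hV
      refine ⟨{x | f x ∈ U ∧ p U x ∈ V}, Set.mem_iUnion.2 ⟨e (some (j, i)), ?_⟩, hxU, hxV⟩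
      simp only [Equiv.symm_apply_apply]
      exact ⟨U, hU, V, hV, rfl⟩
  · obtain ⟨A, hA1, hA0, -⟩ := PH.exists_monotoneOn_nonneg_ge
    obtain ⟨B, hB1, -, -⟩ := PK.exists_monotoneOn_nonneg_ge
    refine ⟨Polynomial.C C * B.comp (Q.comp (Polynomial.X + 2 * A) + 1) + 2 * A,
      fun lam hlam => ?_⟩
    have hAlam := hA0 lam hlam.le
    have hR : 0 < Q.eval (lam + 2 * A.eval lam) + 1 := by
      linarith [hQ0 (lam + 2 * A.eval lam) (by linarith)]
    obtain ⟨𝒰, h𝒰c, h𝒰l, h𝒰m, h𝒰d⟩ := hPH lam hlam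
    obtain ⟨𝒱, h𝒱c, h𝒱l, h𝒱m, h𝒱d⟩ := hPK _ hR
    obtain ⟨p, hp⟩ := hproj (A.eval lam)
    have h𝒰D : FamilyDiamLE (wordDist (f '' S)) 𝒰 (A.eval lam) := fun U hU x hx y hy =>
      (h𝒰d U hU x hx y hy).trans (hA1 lam hlam.le)
    refine ⟨fiberedFamily f p 𝒰 𝒱, fun x => ?_, fun T hT => ?_, fun F hF hne => ?_, ?_⟩
    · obtain ⟨U, hU, hxU⟩ := h𝒰c (f x)
      obtain ⟨V, hV, hxV⟩ := h𝒱c (p U x)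
      exact ⟨_, ⟨U, hU, V, hV, rfl⟩, hxU, hxV⟩
    · obtain ⟨U, hU, hTU⟩ := h𝒰l (f '' T) (by
        rintro _ ⟨x, hx, rfl⟩ _ ⟨y, hy, rfl⟩
        exact (wordDist_map_le f hSsymm hSgen x y).trans (hT x hx y hy))
      rw [Set.image_subset_iff] at hTU
      obtain ⟨V, hV, hTV⟩ := h𝒱l (p U '' T) (by
        rintro _ ⟨x, hx, rfl⟩ _ ⟨y, hy, rfl⟩
        have h1 := (hp U (h𝒰D U hU) x y (hTU hx) (hTU hy)).1
        have h2 := hQmono (wordDist S x y + 2 * A.eval lam) (lam + 2 * A.eval lam)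
          (by linarith [wordDist_nonneg (S := S) x y]) (by linarith [hT x hx y hy])
        linarith)
      rw [Set.image_subset_iff] at hTV
      exact ⟨_, ⟨U, hU, V, hV, rfl⟩, fun x hx => ⟨hTU hx, hTV hx⟩⟩
    · exact (h𝒰m.fiberedFamily h𝒱m F hF hne).trans (Nat.le_succ _)
    · rintro _ ⟨U, hU, V, hV, rfl⟩ x hx y hy
      refine (hp U (h𝒰D U hU) x y hx.1 hy.1).2.trans ?_
      simp only [Polynomial.eval_add, Polynomial.eval_mul, Polynomial.eval_C,
        Polynomial.eval_comp, Polynomial.eval_X, Polynomial.eval_one, Polynomial.eval_ofNat]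
      gcongr
      exact (h𝒱d V hV _ hx.2 _ hy.2).trans (hB1 _ hR.le)
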